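/- (Lemma 3.14 A.) Let f_1, f_2, … be a bounded sequence of non-negative elements of ℓ^1 (i.e., sup_i ∑_{m∈ℕ} f_i(m) < ∞ with f_i(m) ≥ 0), and let ε > 0. Then there exist natural numbers n_1 < n_2 < ⋯ such that for every i: ∑_{j≠i} f_{n_i}(n_j) < ε. -/

import Mathlib

open MeasureTheory Filter
open scoped ENNReal NNReal BigOperators

noncomputable section

variable {E : Type*} [NormedAddCommGroup E] [NormedSpace ℝ E]

/-- `x` is `K`-equivalent to the usual `ℓ^q` basis. -/
def IsLqBasisEquiv (q K : ℝ) (x : ℕ → E) : Prop :=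
  ∀ (s : Finset ℕ) (a : ℕ → ℝ),
    (1 / K) * (∑ k ∈ s, |a k| ^ q) ^ (1 / q) ≤ ‖∑ k ∈ s, a k • x k‖ ∧
      ‖∑ k ∈ s, a k • x k‖ ≤ K * (∑ k ∈ s, |a k| ^ q) ^ (1 / q)

/-- `x` is `K`-equivalent to the usual `ℓ^q_n` basis. -/
def IsLqBasisEquivFin (q K : ℝ) {n : ℕ} (x : Fin n → E) : Prop :=
  ∀ a : Fin n → ℝ,
    (1 / K) * (∑ k, |a k| ^ q) ^ (1 / q) ≤ ‖∑ k, a k • x k‖ ∧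
      ‖∑ k, a k • x k‖ ≤ K * (∑ k, |a k| ^ q) ^ (1 / q)

/-- `x` is `u`-unconditional. -/
def IsUnconditionalWith (u : ℝ) (x : ℕ → E) : Prop :=
  ∀ (s : Finset ℕ) (c ε : ℕ → ℝ), (∀ k ∈ s, |ε k| = 1) →
    ‖∑ k ∈ s, (ε k * c k) • x k‖ ≤ u * ‖∑ k ∈ s, c k • x k‖

/-- `x` is unconditional. -/
def IsUnconditional (x : ℕ → E) : Prop :=
  ∃ u : ℝ, 1 ≤ u ∧ IsUnconditionalWith u x

/-- Finite version of `u`-unconditionality. -/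
def IsUnconditionalWithFin (u : ℝ) {n : ℕ} (x : Fin n → E) : Prop :=
  ∀ (c ε : Fin n → ℝ), (∀ k, |ε k| = 1) →
    ‖∑ k, (ε k * c k) • x k‖ ≤ u * ‖∑ k, c k • x k‖

/-- The measure `μ` is atomless: every measurable set of positive measure contains a
measurable subset of strictly smaller positive measure. -/
def Atomless {Ω : Type*} [MeasurableSpace Ω] (μ : Measure Ω) : Prop :=
  ∀ A : Set Ω, MeasurableSet A → 0 < μ A →
    ∃ B, B ⊆ A ∧ MeasurableSet B ∧ 0 < μ B ∧ μ B < μ A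

/-- The family `(|f n|^p)` is uniformly integrable. -/
def UnifIntPow {Ω : Type*} [MeasurableSpace Ω] (μ : Measure Ω) (p : ℝ) (f : ℕ → Ω → ℝ) : Prop :=
  ∀ ε : ℝ, 0 < ε → ∃ δ : ℝ, 0 < δ ∧ ∀ n, ∀ A : Set Ω, MeasurableSet A →
    μ A ≤ ENNReal.ofReal δ → ∫ x in A, |f n x| ^ p ∂μ ≤ ε

/-- `(f n)` is weakly null in `L^p(μ)`. -/
def WeaklyNullLp {Ω : Type*} [MeasurableSpace Ω] (μ : Measure Ω) (p : ℝ≥0∞)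
    (f : ℕ → Lp ℝ p μ) : Prop :=
  ∀ q : ℝ≥0∞, p⁻¹ + q⁻¹ = 1 → ∀ g : Lp ℝ q μ,
    Tendsto (fun n => ∫ x, (f n : Ω → ℝ) x * (g : Ω → ℝ) x ∂μ) atTop (nhds 0)

/-- The `p`-modulus of uniform integrability. -/
def omegaP {Ω : Type*} [MeasurableSpace Ω] (μ : Measure Ω) (p : ℝ) (f : Ω → ℝ) (ε : ℝ) : ℝ :=
  sSup {r : ℝ | ∃ A : Set Ω, MeasurableSet A ∧ μ A ≤ ENNReal.ofReal ε ∧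
    r = (∫ x in A, |f x| ^ p ∂μ) ^ (1 / p)}


/-- Every infinite set of naturals contains infinitely many pairwise disjoint infinite subsets. -/
theorem Set.Infinite.exists_pairwise_disjoint_infinite_subsets {A : Set ℕ} (hA : A.Infinite) :
    ∃ N : ℕ → Set ℕ, (∀ p, (N p).Infinite) ∧ (∀ p, N p ⊆ A) ∧
      Pairwise fun p q => Disjoint (N p) (N q) := by
  have hinj : Function.Injective (Nat.nth (· ∈ A)) := (Nat.nth_strictMono hA).injective
  refine ⟨fun p => Set.range fun k => Nat.nth (· ∈ A) (Nat.pair p k), fun p => ?_, ?_, ?_⟩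
  · refine Set.infinite_range_of_injective fun a b h => ?_
    exact (Nat.pair_eq_pair.1 (hinj h)).2
  · rintro p _ ⟨k, rfl⟩
    exact Nat.nth_mem_of_infinite hA _
  · intro p q hpq
    rw [Set.disjoint_left]
    rintro _ ⟨a, rfl⟩ ⟨b, hb⟩
    exact hpq (Nat.pair_eq_pair.1 (hinj hb)).1.symm

/-- Rosenthal's disjointification lemma, in terms of infinite sets of indices. -/
theorem exists_infinite_offDiag_tsum_lt {f : ℕ → ℕ → ℝ} (hnn : ∀ i m, 0 ≤ f i m)
    (hsum : ∀ i, Summable (f i)) {ε : ℝ} (k : ℕ) {A : Set ℕ} (hA : A.Infinite)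
    (hAk : ∀ i ∈ A, ∑' m, (A \ {i}).indicator (f i) m < k * ε) :
    ∃ B : Set ℕ, B.Infinite ∧ ∀ i ∈ B, ∑' m, (B \ {i}).indicator (f i) m < ε := by
  induction k generalizing A with
  | zero =>
    obtain ⟨i, hi⟩ := hA.nonempty
    have h := hAk i hi
    have h' : 0 ≤ ∑' m, (A \ {i}).indicator (f i) m :=
      tsum_nonneg fun m => Set.indicator_nonneg (fun m _ => hnn i m) m
    simp only [Nat.cast_zero, zero_mul] at h
    exact absurd h h'.not_gt
  | succ k ih =>
    obtain ⟨N, hNinf, hNA, hN⟩ := hA.exists_pairwise_disjoint_infinite_subsets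
    by_cases hgood : ∃ p, ∀ i ∈ N p, ∑' m, (N p \ {i}).indicator (f i) m < ε
    · obtain ⟨p, hp⟩ := hgood
      exact ⟨N p, hNinf p, hp⟩
    · push Not at hgood
      choose r hrN hr using hgood
      have hr_eq : ∀ {p q}, r q ∈ N p → q = p := fun {p q} h => by
        by_contra hne
        exact Set.disjoint_left.1 (hN hne) (hrN q) h
      refine ih (A := Set.range r) ?_ ?_
      · refine Set.infinite_range_of_injective fun p q h => ?_
        exact hr_eq (h ▸ hrN q)
      · rintro _ ⟨p, rfl⟩
        have hdisj : Disjoint (Set.range r \ {r p}) (N p \ {r p}) := by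
          rw [Set.disjoint_left]
          rintro _ ⟨⟨q, rfl⟩, hq⟩ ⟨hqN, -⟩
          exact hq (congrArg r (hr_eq hqN))
        have hsub : (Set.range r \ {r p}) ∪ (N p \ {r p}) ⊆ A \ {r p} := by
          rintro m (⟨⟨q, rfl⟩, hq⟩ | ⟨hm, hne⟩)
          · exact ⟨hNA q (hrN q), hq⟩
          · exact ⟨hNA p hm, hne⟩
        have hle := ((hsum (r p)).indicator _).tsum_le_tsum
          (Set.indicator_le_indicator_of_subset hsub (hnn (r p))) ((hsum (r p)).indicator _)
        rw [Set.indicator_union_of_disjoint hdisj,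
          ((hsum (r p)).indicator _).tsum_add ((hsum (r p)).indicator _)] at hle
        have hlt := hAk (r p) (hNA p (hrN p))
        have hge := hr p
        push_cast at hlt
        linarith

/-- (Lemma 3.14 A.) -/
theorem statement13 (f : ℕ → ℕ → ℝ) (hnn : ∀ i m, 0 ≤ f i m)
    (hsum : ∀ i, Summable (f i)) (M : ℝ) (hM : ∀ i, ∑' m, f i m ≤ M)
    (ε : ℝ) (hε : 0 < ε) :
    ∃ n : ℕ → ℕ, StrictMono n ∧
      ∀ i, (∑' j : ℕ, if j = i then 0 else f (n i) (n j)) < ε := by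
  obtain ⟨k, hk⟩ := exists_nat_gt (M / ε)
  obtain ⟨B, hB, hBε⟩ := exists_infinite_offDiag_tsum_lt hnn hsum (ε := ε) k Set.infinite_univ
    fun i _ => by
      refine lt_of_le_of_lt ?_ ((div_lt_iff₀ hε).1 hk)
      exact (((hsum i).indicator _).tsum_le_tsum
        (Set.indicator_le_self' fun m _ => hnn i m) (hsum i)).trans (hM i)
  have hmono : StrictMono (Nat.nth (· ∈ B)) := Nat.nth_strictMono hB
  refine ⟨Nat.nth (· ∈ B), hmono, fun i => ?_⟩
  set n := Nat.nth (· ∈ B)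
  have hmem : ∀ j, n j ∈ B := Nat.nth_mem_of_infinite hB
  refine lt_of_le_of_lt ?_ (hBε (n i) (hmem i))
  have heq : (fun j => if j = i then 0 else f (n i) (n j)) =
      (B \ {n i}).indicator (f (n i)) ∘ n := by
    funext j
    by_cases hj : j = i
    · simp [hj]
    · simp [hj, Set.indicator, hmem j, hmono.injective.eq_iff]
  rw [heq]
  exact tsum_comp_le_tsum_of_inj ((hsum (n i)).indicator _)
    (fun m => Set.indicator_nonneg (fun m _ => hnn (n i) m) m) hmono.injective

end
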